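/- arXiv:2202.13256 — 3 statements merged into one kernel-verified Lean document; each statement's English description precedes it below -/
import Mathlib

section
/- Let k be a positive integer, let j be a natural number with j < u_k := 2·3^(k-1), and let i ∈ {0, 1, 2}. Set m := i·u_k + j. Then 2^m ≡ 2^j (mod 3^k), and 2^m is the smallest power of two whose last k+1 ternary digits match those of 2^m: for every natural number ℓ < m, 2^ℓ ≢ 2^m (mod 3^(k+1)). -/
/-- Let `k ≥ 1`, let `j < u_k := 2 * 3 ^ (k - 1)`, and let `i ∈ {0, 1, 2}`.
Set `m := i * u_k + j`. Then `2 ^ m ≡ 2 ^ j [MOD 3 ^ k]`, and `2 ^ m` is the smallest power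
of two whose last `k + 1` ternary digits match those of `2 ^ m`: for every `ℓ < m`,
`2 ^ ℓ` is not congruent to `2 ^ m` modulo `3 ^ (k + 1)`. -/
theorem two_pow_smallest_with_matching_trailing_digits (k j i m : ℕ) (hk : 0 < k)
    (hj : j < 2 * 3 ^ (k - 1)) (hi : i ≤ 2) (hm : m = i * (2 * 3 ^ (k - 1)) + j) :
    2 ^ m ≡ 2 ^ j [MOD 3 ^ k] ∧
      ∀ ℓ < m, ¬ (2 ^ ℓ ≡ 2 ^ m [MOD 3 ^ (k + 1)]) := by
  obtain ⟨n, rfl⟩ : ∃ n, k = n + 1 := ⟨k - 1, by omega⟩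
  simp only [Nat.add_sub_cancel] at hj hm
  constructor
  · have ht : 2 ^ (2 * 3 ^ n) ≡ 1 [MOD 3 ^ (n + 1)] := by
      have h := Nat.ModEq.pow_totient (n := 3 ^ (n + 1)) (x := 2)
        (Nat.Coprime.pow_right _ (by norm_num))
      rw [Nat.totient_prime_pow_succ Nat.prime_three] at h
      rwa [mul_comm] at h
    have h2 := (ht.pow i).mul_right (2 ^ j)
    rw [one_pow, one_mul, ← pow_mul, ← pow_add, mul_comm _ i, ← hm] at h2
    exact h2
  · intro l hl h
    obtain ⟨d, rfl⟩ : ∃ d, m = l + d := ⟨m - l, by omega⟩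
    have h1 : 1 ≡ 2 ^ d [MOD 3 ^ (n + 1 + 1)] := by
      have h' : 2 ^ l * 1 ≡ 2 ^ l * 2 ^ d [MOD 3 ^ (n + 1 + 1)] := by
        rwa [mul_one, ← pow_add]
      refine Nat.ModEq.cancel_left_of_coprime ?_ h'
      exact Nat.Coprime.pow _ _ (by norm_num)
    have h3 : 1 ≡ 2 ^ d [MOD 3] := h1.of_dvd (dvd_pow_self 3 (by omega))
    have hd : Even d := by
      by_contra hodd
      obtain ⟨e, rfl⟩ := Nat.not_even_iff_odd.mp hodd
      have h4 : 2 ^ (2 * e + 1) ≡ 2 [MOD 3] := by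
        have h5 : (2 ^ 2) ^ e * 2 ≡ 1 ^ e * 2 [MOD 3] :=
          (Nat.ModEq.pow e (by decide)).mul_right 2
        rwa [← pow_mul, ← pow_succ, one_pow, one_mul] at h5
      exact absurd (h3.trans h4) (by decide)
    obtain ⟨e, rfl⟩ := hd
    have h6 := ZMod.orderOf_one_add_prime Nat.prime_three (by norm_num) (n + 1)
    have h7 : (1 + (3 : ℕ) : ZMod (3 ^ (n + 1 + 1))) ^ e = 1 := by
      have h8 := (ZMod.natCast_eq_natCast_iff _ _ _).mpr h1
      push_cast at h8 ⊢
      rw [← two_mul, pow_mul] at h8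
      refine Eq.trans ?_ h8.symm
      norm_num
    have h9 := orderOf_dvd_of_pow_eq_one h7
    rw [h6] at h9
    have h10 := Nat.le_of_dvd (by omega) h9
    rw [pow_succ] at h10
    have h11 : i * (2 * 3 ^ n) ≤ 2 * (2 * 3 ^ n) := Nat.mul_le_mul_right _ hi
    omega
end

section
/- For every natural number x, every ternary digit of x lies in {0, 1} if and only if every ternary digit of 2x lies in {0, 2}; equivalently, for all i, (x / 3^i) % 3 ≠ 2 for every i if and only if (2x / 3^i) % 3 ≠ 1 for every i. -/
theorem digit_split (y d : ℕ) :
    (∀ i : ℕ, y / 3 ^ i % 3 ≠ d) ↔ (y % 3 ≠ d ∧ ∀ i : ℕ, y / 3 / 3 ^ i % 3 ≠ d) := by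
  constructor
  · intro h
    refine ⟨by simpa using h 0, fun i => ?_⟩
    have := h (i + 1)
    rwa [pow_succ', ← Nat.div_div_eq_div_mul] at this
  · rintro ⟨h0, h⟩ i
    cases i with
    | zero => simpa using h0
    | succ i =>
      rw [pow_succ', ← Nat.div_div_eq_div_mul]
      exact h i

/-- For every natural `x`, every ternary digit of `x` lies in `{0, 1}` if and only if every
ternary digit of `2 * x` lies in `{0, 2}`. -/
theorem ternary_digits_no_two_iff_double_no_one (x : ℕ) :
    (∀ i : ℕ, x / 3 ^ i % 3 ≠ 2) ↔ (∀ i : ℕ, 2 * x / 3 ^ i % 3 ≠ 1) := by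
  induction x using Nat.strong_induction_on with
  | _ x ih =>
    rcases Nat.eq_zero_or_pos x with rfl | hx
    · simp
    · rw [digit_split x, digit_split (2 * x)]
      by_cases h : x % 3 = 2
      · have h2 : 2 * x % 3 = 1 := by omega
        simp [h, h2]
      · have h2 : 2 * x % 3 ≠ 1 := by omega
        have h3 : 2 * x / 3 = 2 * (x / 3) := by omega
        rw [h3, ih (x / 3) (by omega)]
        exact ⟨fun a => ⟨h2, a.2⟩, fun a => ⟨h, a.2⟩⟩
end

section
/- For a digit χ ∈ {0, 1, 2} and a positive integer k, define ρ_χ(k) as the least natural number n such that 2^n ≥ 3^(k-1) and (2^n / 3^i) % 3 ≠ χ for all i < k. Then for every positive integer k, ρ_1(k) = ρ_2(k) + 1. -/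
lemma digits_split (k m c : ℕ) :
    (∀ i < k + 1, m / 3 ^ i % 3 ≠ c) ↔ m % 3 ≠ c ∧ ∀ i < k, m / 3 / 3 ^ i % 3 ≠ c := by
  constructor
  · intro h
    refine ⟨by simpa using h 0 (by omega), fun i hi => ?_⟩
    have := h (i + 1) (by omega)
    rwa [pow_succ', ← Nat.div_div_eq_div_mul] at this
  · rintro ⟨h0, h⟩ i hi
    cases i with
    | zero => simpa using h0
    | succ i =>
      rw [pow_succ', ← Nat.div_div_eq_div_mul]
      exact h i (by omega)

lemma digits_double (k : ℕ) : ∀ m : ℕ,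
    (∀ i < k, m / 3 ^ i % 3 ≠ 2) ↔ (∀ i < k, (2 * m) / 3 ^ i % 3 ≠ 1) := by
  induction k with
  | zero => intro m; simp
  | succ k ih =>
    intro m
    rw [digits_split, digits_split]
    by_cases hm : m % 3 = 2
    · have : (2 * m) % 3 = 1 := by omega
      simp [hm, this]
    · have h1 : (2 * m) % 3 ≠ 1 := by omega
      have h2 : 2 * m / 3 = 2 * (m / 3) := by omega
      rw [h2, ih (m / 3)]
      simp [hm, h1]

/-- For `χ ∈ {0, 1, 2}` and a positive integer `k`, define `ρ_χ(k)` as the least natural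
number `n` such that `2 ^ n ≥ 3 ^ (k - 1)` and the digit `χ` occurs nowhere in the last `k`
ternary digits of `2 ^ n`. Then for every positive integer `k`, `ρ_1(k) = ρ_2(k) + 1`. -/
theorem rho_one_eq_rho_two_add_one (k : ℕ) (hk : 0 < k) (r₁ r₂ : ℕ)
    (h₁ : IsLeast {n : ℕ | 3 ^ (k - 1) ≤ 2 ^ n ∧ ∀ i < k, 2 ^ n / 3 ^ i % 3 ≠ 1} r₁)
    (h₂ : IsLeast {n : ℕ | 3 ^ (k - 1) ≤ 2 ^ n ∧ ∀ i < k, 2 ^ n / 3 ^ i % 3 ≠ 2} r₂) :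
    r₁ = r₂ + 1 := by
  obtain ⟨⟨a1, b1⟩, l1⟩ := h₁
  obtain ⟨⟨a2, b2⟩, l2⟩ := h₂
  apply le_antisymm
  · apply l1
    refine ⟨?_, ?_⟩
    · rw [pow_succ]; omega
    · rw [pow_succ']
      exact (digits_double k _).1 b2
  · cases r₁ with
    | zero => exact absurd (by norm_num) (b1 0 hk)
    | succ n =>
      rw [pow_succ'] at a1 b1
      have hle : r₂ ≤ n := by
        apply l2
        refine ⟨?_, (digits_double k _).2 b1⟩
        by_contra hlt
        apply b1 (k - 1) (by omega)
        have : 2 * 2 ^ n / 3 ^ (k - 1) = 1 := by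
          apply Nat.div_eq_of_lt_le <;> omega
        rw [this]
      omega
end
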